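/- arXiv:1810.09094 — 5 statements merged into one kernel-verified Lean document; each statement's English description precedes it below -/
import Mathlib

section
/- For every point p = (x0,y0,z0,t0) ∈ k⁴ and every weight vector α = (α0,α1,α2,α3) with αi < 0 for all i and α0 + α3 = α1 + α2, the map ν : k[Q] → ℝ ∪ {+∞} defined by ν(0) = +∞ and ν(f) = sup{ν_p^α(R) : R ∈ k[x,y,z,t], π(R) = f} for f ≠ 0 is a well-defined valuation on k[Q] taking all of its values in ℝ^{≤0} ∪ {+∞}, and it is centered at infinity, i.e. ν(g) < 0 for some g ∈ k[Q]. -/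
noncomputable section

open MvPolynomial

/-- The polynomial `q = xt - yz` in `k[x,y,z,t]` (variables `x,y,z,t` are `X 0, X 1, X 2, X 3`). -/
def qpoly (k : Type) [Field k] : MvPolynomial (Fin 4) k :=
  X 0 * X 3 - X 1 * X 2

/-- The coordinate ring `k[Q] = k[x,y,z,t]/(xt - yz - 1)` of the affine quadric threefold. -/
abbrev QuadRing (k : Type) [Field k] : Type :=
  MvPolynomial (Fin 4) k ⧸ Ideal.span {qpoly k - 1}

/-- The canonical projection `π : k[x,y,z,t] → k[Q]`. -/
def qmk (k : Type) [Field k] : MvPolynomial (Fin 4) k →+* QuadRing k :=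
  Ideal.Quotient.mk (Ideal.span {qpoly k - 1})

/-- A valuation on a commutative `k`-algebra `A`, with values in `ℝ ∪ {+∞}`:
`ν⁻¹({+∞}) = {0}`, `ν(a) = 0` for `a ∈ k*`, `ν(fg) = ν f + ν g`, and
`ν(f + g) ≥ min (ν f) (ν g)`. -/
def IsValuation (k : Type) [Field k] (A : Type) [CommRing A] [Algebra k A]
    (ν : A → WithTop ℝ) : Prop :=
  (∀ f : A, ν f = ⊤ ↔ f = 0) ∧
  (∀ a : k, a ≠ 0 → ν (algebraMap k A a) = 0) ∧
  (∀ f g : A, ν (f * g) = ν f + ν g) ∧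
  (∀ f g : A, min (ν f) (ν g) ≤ ν (f + g))

/-- The monomial valuation `ν_p^α` on `k[x,y,z,t]` at the point `p` with weights `α`:
the minimum of `⟨I, α⟩` over the exponents `I` appearing in the expansion of `R` in the
shifted variables `x - p₀, y - p₁, z - p₂, t - p₃` (and `+∞` on the zero polynomial). -/
def mvalP (k : Type) [Field k] (p : Fin 4 → k) (α : Fin 4 → ℝ)
    (R : MvPolynomial (Fin 4) k) : WithTop ℝ :=
  (MvPolynomial.aeval (fun i => X i + C (p i)) R : MvPolynomial (Fin 4) k).support.inf
    fun I => ((∑ i, α i * (I i : ℝ) : ℝ) : WithTop ℝ)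

/-- The monomial valuation `ν_0^α` on `k[x,y,z,t]` at the origin with weights `α`. -/
def mvalO (k : Type) [Field k] (α : Fin 4 → ℝ)
    (R : MvPolynomial (Fin 4) k) : WithTop ℝ :=
  R.support.inf fun I => ((∑ i, α i * (I i : ℝ) : ℝ) : WithTop ℝ)

/-- The map `ν : k[Q] → ℝ ∪ {+∞}` given by `ν(f) = sup {ν_p^α(R) : π R = f}`. -/
def nuSup (k : Type) [Field k] (p : Fin 4 → k) (α : Fin 4 → ℝ)
    (f : QuadRing k) : WithTop ℝ :=
  sSup {v : WithTop ℝ | ∃ R : MvPolynomial (Fin 4) k, qmk k R = f ∧ mvalP k p α R = v}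

/-- The set `𝒱₀` of valuations on `k[Q]` obtained from monomial valuations at points
`p ∈ k⁴` with weights `α ∈ (ℝ^{<0})⁴` satisfying `α₀ + α₃ = α₁ + α₂`. -/
def V0 (k : Type) [Field k] : Set (QuadRing k → WithTop ℝ) :=
  {ν | ∃ (p : Fin 4 → k) (α : Fin 4 → ℝ),
      (∀ i, α i < 0) ∧ α 0 + α 3 = α 1 + α 2 ∧ ν = nuSup k p α}

/-- The Jacobian determinant `Jac(R₁,R₂,R₃,R₄)` of four polynomials in `k[x,y,z,t]`. -/
def jac (k : Type) [Field k] (R : Fin 4 → MvPolynomial (Fin 4) k) :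
    MvPolynomial (Fin 4) k :=
  (Matrix.of fun i j : Fin 4 => MvPolynomial.pderiv j (R i)).det

/-- The monomial valuation on `k[X,Y]` with weights `w = (w₁, w₂)`. -/
def mval2 (k : Type) [Field k] (w : Fin 2 → ℝ)
    (R : MvPolynomial (Fin 2) k) : WithTop ℝ :=
  R.support.inf fun I => ((∑ i, w i * (I i : ℝ) : ℝ) : WithTop ℝ)

open Classical in
/-- The `(w₁,w₂)`-leading part of `R ∈ k[X,Y]`: the sum of the terms of `R` whose
weighted degree realizes the monomial valuation of `R` with weights `w`. -/
def leadPart2 (k : Type) [Field k] (w : Fin 2 → ℝ) (R : MvPolynomial (Fin 2) k) :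
    MvPolynomial (Fin 2) k :=
  ∑ I ∈ R.support.filter
      (fun I => ((∑ i, w i * (I i : ℝ) : ℝ) : WithTop ℝ) = mval2 k w R),
    monomial I (R.coeff I)

open Classical in
/-- The `α`-leading part `R^w` of `R ∈ k[x,y,z,t]` (with respect to the monomial
valuation at the origin with weights `α`). -/
def leadPart4 (k : Type) [Field k] (α : Fin 4 → ℝ) (R : MvPolynomial (Fin 4) k) :
    MvPolynomial (Fin 4) k :=
  ∑ I ∈ R.support.filter
      (fun I => ((∑ i, α i * (I i : ℝ) : ℝ) : WithTop ℝ) = mvalO k α R),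
    monomial I (R.coeff I)

/-- `(f₁, f₂)` is a component of an automorphism of `Q`: there is a `k`-algebra
automorphism `σ` of `k[Q]` with `σ x = f₁` and `σ y = f₂`. -/
def IsComponent (k : Type) [Field k] (f1 f2 : QuadRing k) : Prop :=
  ∃ σ : QuadRing k ≃ₐ[k] QuadRing k, σ (qmk k (X 0)) = f1 ∧ σ (qmk k (X 1)) = f2

/-- `(f₁, f₂)` is critically resonant with respect to `ν`. -/
def CriticallyResonant (k : Type) [Field k] (ν : QuadRing k → WithTop ℝ)
    (f1 f2 : QuadRing k) : Prop :=
  (∃ (m : ℕ) (lam : k), 1 ≤ m ∧ lam ≠ 0 ∧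
      ν f1 < ν (f1 - algebraMap k (QuadRing k) lam * f2 ^ m) ∧ ν f1 = m • ν f2) ∨
  (∃ (m : ℕ) (lam : k), 1 ≤ m ∧ lam ≠ 0 ∧
      ν f2 < ν (f2 - algebraMap k (QuadRing k) lam * f1 ^ m) ∧ ν f2 = m • ν f1)

section MonomialValuation

variable {k : Type} [Field k] {α : Fin 4 → ℝ}

lemma mvalO_eq_inf_weight (R : MvPolynomial (Fin 4) k) :
    mvalO k α R = R.support.inf fun I => ((Finsupp.weight α I : ℝ) : WithTop ℝ) := by
  unfold mvalO
  refine Finset.inf_congr rfl fun I _ => ?_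
  rw [Finsupp.weight_apply, Finsupp.sum_fintype _ _ (by simp)]
  simp [mul_comm]

lemma coe_le_mvalO_iff {c : ℝ} {R : MvPolynomial (Fin 4) k} :
    (c : WithTop ℝ) ≤ mvalO k α R ↔ ∀ I, coeff I R ≠ 0 → c ≤ Finsupp.weight α I := by
  simp [mvalO_eq_inf_weight, Finset.le_inf_iff]

lemma mvalO_zero : mvalO k α 0 = ⊤ := by simp [mvalO]

lemma exists_mvalO_eq_weight {R : MvPolynomial (Fin 4) k} (hR : R ≠ 0) :
    ∃ I : Fin 4 →₀ ℕ, mvalO k α R = ((Finsupp.weight α I : ℝ) : WithTop ℝ) := by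
  obtain ⟨I, -, hI⟩ := Finset.exists_mem_eq_inf R.support (support_nonempty.mpr hR)
    fun I => ((Finsupp.weight α I : ℝ) : WithTop ℝ)
  exact ⟨I, by rw [mvalO_eq_inf_weight, hI]⟩

lemma min_le_mvalO_add (R S : MvPolynomial (Fin 4) k) :
    min (mvalO k α R) (mvalO k α S) ≤ mvalO k α (R + S) := by
  classical
  rw [mvalO_eq_inf_weight (R + S)]
  refine Finset.le_inf fun I hI => ?_
  rw [mvalO_eq_inf_weight, mvalO_eq_inf_weight]
  rcases Finset.mem_union.mp (support_add hI) with h | h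
  · exact min_le_of_left_le (Finset.inf_le h)
  · exact min_le_of_right_le (Finset.inf_le h)

/-- A polynomial has monomial valuation `c` exactly when its weighted homogeneous components below
`c` vanish and the one of weight `c` does not. -/
lemma mvalO_eq_coe_iff {c : ℝ} {R : MvPolynomial (Fin 4) k} :
    mvalO k α R = c ↔
      (c : WithTop ℝ) ≤ mvalO k α R ∧ weightedHomogeneousComponent α c R ≠ 0 := by
  classical
  constructor
  · intro h
    refine ⟨h.ge, fun h0 => ?_⟩
    have hR : R ≠ 0 := by rintro rfl; simp [mvalO_zero] at h
    obtain ⟨I, hI, hI'⟩ := Finset.exists_mem_eq_inf R.support (support_nonempty.mpr hR)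
      fun I => ((Finsupp.weight α I : ℝ) : WithTop ℝ)
    rw [← mvalO_eq_inf_weight, h] at hI'
    have := congrArg (coeff I) h0
    rw [coeff_weightedHomogeneousComponent, if_pos (by exact_mod_cast hI'.symm)] at this
    exact mem_support_iff.mp hI (by simpa using this)
  · rintro ⟨h1, h2⟩
    obtain ⟨I, hI⟩ := exists_coeff_ne_zero h2
    rw [coeff_weightedHomogeneousComponent] at hI
    split_ifs at hI with hw
    · refine le_antisymm ?_ h1
      rw [mvalO_eq_inf_weight]
      exact (Finset.inf_le (mem_support_iff.mpr hI)).trans (by rw [hw])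
    · exact absurd rfl hI

lemma weightedHomogeneousComponent_eq_zero_of_lt_mvalO {c : ℝ} {R : MvPolynomial (Fin 4) k}
    (h : (c : WithTop ℝ) < mvalO k α R) : weightedHomogeneousComponent α c R = 0 := by
  by_contra h0
  exact h.ne (mvalO_eq_coe_iff.mpr ⟨h.le, h0⟩).symm

lemma add_le_mvalO_mul {a b : ℝ} {R S : MvPolynomial (Fin 4) k}
    (hR : (a : WithTop ℝ) ≤ mvalO k α R) (hS : (b : WithTop ℝ) ≤ mvalO k α S) :
    ((a + b : ℝ) : WithTop ℝ) ≤ mvalO k α (R * S) := by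
  classical
  rw [coe_le_mvalO_iff] at *
  intro I hI
  rw [coeff_mul] at hI
  obtain ⟨⟨J, K⟩, hJK, h⟩ := Finset.exists_ne_zero_of_sum_ne_zero hI
  rw [← Finset.HasAntidiagonal.mem_antidiagonal.mp hJK, map_add]
  exact add_le_add (hR J (left_ne_zero_of_mul h)) (hS K (right_ne_zero_of_mul h))

lemma weightedHomogeneousComponent_add_mul {a b : ℝ} {R S : MvPolynomial (Fin 4) k}
    (hR : (a : WithTop ℝ) ≤ mvalO k α R) (hS : (b : WithTop ℝ) ≤ mvalO k α S) :
    weightedHomogeneousComponent α (a + b) (R * S) =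
      weightedHomogeneousComponent α a R * weightedHomogeneousComponent α b S := by
  classical
  rw [coe_le_mvalO_iff] at *
  ext I
  rw [coeff_weightedHomogeneousComponent, coeff_mul, coeff_mul,
    ← Finset.sum_const_zero (s := Finset.HasAntidiagonal.antidiagonal I), ← Finset.sum_ite_irrel]
  refine Finset.sum_congr rfl fun JK hJK => ?_
  rw [coeff_weightedHomogeneousComponent, coeff_weightedHomogeneousComponent,
    ← Finset.HasAntidiagonal.mem_antidiagonal.mp hJK, map_add]
  by_cases h1 : coeff JK.1 R = 0
  · simp [h1]
  by_cases h2 : coeff JK.2 S = 0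
  · simp [h2]
  have := hR _ h1
  have := hS _ h2
  by_cases h3 : Finsupp.weight α JK.1 = a
  · by_cases h4 : Finsupp.weight α JK.2 = b
    · simp [h3, h4]
    · rw [if_neg (fun h => h4 (by linarith))]; simp [h4]
  · rw [if_neg (fun h => h3 (by linarith))]; simp [h3]

lemma weightedHomogeneousComponent_mul_of_isWeightedHomogeneous {e : ℝ}
    {L : MvPolynomial (Fin 4) k} (hL : L.IsWeightedHomogeneous α e) (c : ℝ)
    (G : MvPolynomial (Fin 4) k) :
    weightedHomogeneousComponent α c (L * G) =
      L * weightedHomogeneousComponent α (c - e) G := by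
  classical
  ext I
  rw [coeff_weightedHomogeneousComponent, coeff_mul, coeff_mul,
    ← Finset.sum_const_zero (s := Finset.HasAntidiagonal.antidiagonal I), ← Finset.sum_ite_irrel]
  refine Finset.sum_congr rfl fun JK hJK => ?_
  rw [coeff_weightedHomogeneousComponent, ← Finset.HasAntidiagonal.mem_antidiagonal.mp hJK, map_add]
  by_cases h1 : coeff JK.1 L = 0
  · simp [h1]
  · rw [hL h1, mul_ite, mul_zero]
    exact if_congr (by rw [eq_sub_iff_add_eq']) rfl rfl

lemma mvalO_mul_eq {a b : ℝ} {R S : MvPolynomial (Fin 4) k}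
    (hR : mvalO k α R = a) (hS : mvalO k α S = b) :
    mvalO k α (R * S) = ((a + b : ℝ) : WithTop ℝ) := by
  refine mvalO_eq_coe_iff.mpr ⟨add_le_mvalO_mul hR.ge hS.ge, ?_⟩
  rw [weightedHomogeneousComponent_add_mul hR.ge hS.ge]
  exact mul_ne_zero (mvalO_eq_coe_iff.mp hR).2 (mvalO_eq_coe_iff.mp hS).2

lemma coe_lt_mvalO {c : ℝ} {R : MvPolynomial (Fin 4) k} (h : (c : WithTop ℝ) ≤ mvalO k α R)
    (h0 : weightedHomogeneousComponent α c R = 0) : (c : WithTop ℝ) < mvalO k α R :=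
  lt_of_le_of_ne h fun h' => (mvalO_eq_coe_iff.mp h'.symm).2 h0

lemma le_mvalO_of_isWeightedHomogeneous {c : ℝ} {R : MvPolynomial (Fin 4) k}
    (h : R.IsWeightedHomogeneous α c) : (c : WithTop ℝ) ≤ mvalO k α R :=
  coe_le_mvalO_iff.mpr fun _ hI => (h hI).ge

lemma weight_nonpos (hα : ∀ i, α i < 0) (I : Fin 4 →₀ ℕ) : Finsupp.weight α I ≤ 0 := by
  rw [Finsupp.weight_apply]
  exact Finset.sum_nonpos fun i _ => smul_nonpos_of_nonneg_of_nonpos (Nat.zero_le _) (hα i).le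

lemma weight_antitone (hα : ∀ i, α i < 0) : Antitone (Finsupp.weight α : (Fin 4 →₀ ℕ) → ℝ) := by
  intro I J hIJ
  obtain ⟨K, rfl⟩ := le_iff_exists_add.mp hIJ
  rw [map_add]
  linarith [weight_nonpos hα K]

section Quotient

variable {A : Type} [CommRing A] {φ : MvPolynomial (Fin 4) k →+* A}
  {H : MvPolynomial (Fin 4) k} {e : ℝ}

/-- A lift whose leading component is not divisible by the leading component of the relation `H`
has the largest valuation among all lifts of its image. -/
lemma mvalO_le_of_map_eq (hker : ∀ R, φ R = 0 ↔ H ∣ R) (hH : mvalO k α H = e)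
    {c : ℝ} {R S : MvPolynomial (Fin 4) k} (hR : mvalO k α R = c)
    (hdvd : ¬ weightedHomogeneousComponent α e H ∣ weightedHomogeneousComponent α c R)
    (hS : φ S = φ R) : mvalO k α S ≤ c := by
  by_contra! hlt
  obtain ⟨G, hG⟩ := (hker (R - S)).mp (by rw [map_sub, hS, sub_self])
  have hcomp : weightedHomogeneousComponent α c (H * G) = weightedHomogeneousComponent α c R := by
    rw [← hG, map_sub, weightedHomogeneousComponent_eq_zero_of_lt_mvalO hlt, sub_zero]
  have hle : (c : WithTop ℝ) ≤ mvalO k α (H * G) := by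
    rw [coe_le_mvalO_iff]
    intro I hI
    rw [← hG, coeff_sub] at hI
    by_cases h : coeff I R = 0
    · refine coe_le_mvalO_iff.mp hlt.le I fun h' => hI (by rw [h, h', sub_zero])
    · exact coe_le_mvalO_iff.mp hR.ge I h
  have hval : mvalO k α (H * G) = c :=
    mvalO_eq_coe_iff.mpr ⟨hle, hcomp ▸ (mvalO_eq_coe_iff.mp hR).2⟩
  have hG0 : G ≠ 0 := by
    rintro rfl
    simp [mvalO_zero] at hval
  obtain ⟨I, hI⟩ := exists_mvalO_eq_weight (α := α) hG0
  have hc : e + Finsupp.weight α I = c := by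
    have := mvalO_mul_eq hH hI
    rw [hval] at this
    exact_mod_cast this.symm
  rw [← hc, weightedHomogeneousComponent_add_mul hH.ge hI.ge, hc] at hcomp
  exact hdvd ⟨_, hcomp.symm⟩

/-- Every nonzero element of the quotient has a lift whose leading component is not divisible by
the leading component of the relation `H`. -/
lemma exists_lift_not_dvd (hα : ∀ i, α i < 0) (hφ : Function.Surjective φ)
    (hker : ∀ R, φ R = 0 ↔ H ∣ R) (hH : mvalO k α H = e) {f : A} (hf : f ≠ 0) :
    ∃ (R : MvPolynomial (Fin 4) k) (c : ℝ), φ R = f ∧ mvalO k α R = c ∧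
      ¬ weightedHomogeneousComponent α e H ∣ weightedHomogeneousComponent α c R := by
  classical
  have hne : ∀ {R}, φ R = f → R ≠ 0 := by
    rintro R hR rfl
    exact hf (by rw [← hR, map_zero])
  let T : Set (Fin 4 →₀ ℕ) :=
    {I | ∃ R, φ R = f ∧ mvalO k α R = ((Finsupp.weight α I : ℝ) : WithTop ℝ)}
  have hT : T.Nonempty := by
    obtain ⟨R, hR⟩ := hφ f
    obtain ⟨I, hI⟩ := exists_mvalO_eq_weight (α := α) (hne hR)
    exact ⟨I, R, hR, hI⟩
  have hwf := ((Set.isPWO_of_wellQuasiOrderedLE T).image_of_monotone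
    (weight_antitone hα).dual_right).isWF
  obtain ⟨I, ⟨R, hR, hRI⟩, hImin⟩ := hwf.min_mem (hT.image _)
  refine ⟨R, _, hR, hRI, fun ⟨G, hG⟩ => ?_⟩
  set c : ℝ := Finsupp.weight α I with hc
  set G' := weightedHomogeneousComponent α (c - e) G with hG'
  have hG'c : G'.IsWeightedHomogeneous α (c - e) :=
    weightedHomogeneousComponent_isWeightedHomogeneous _ _
  have hG'le := le_mvalO_of_isWeightedHomogeneous hG'c
  have hlead : weightedHomogeneousComponent α c R =
      weightedHomogeneousComponent α e H * G' := by
    have h := weightedHomogeneousComponent_mul_of_isWeightedHomogeneous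
      (weightedHomogeneousComponent_isWeightedHomogeneous (w := α) e H) c G
    rw [← hG] at h
    exact (weightedHomogeneousComponent_isWeightedHomogeneous
      c R).weightedHomogeneousComponent_same.symm.trans h
  have hcomp : weightedHomogeneousComponent α c (R - H * G') = 0 := by
    rw [map_sub, hlead, sub_eq_zero]
    have := weightedHomogeneousComponent_add_mul hH.ge hG'le
    rw [add_sub_cancel, hG'c.weightedHomogeneousComponent_same] at this
    exact this.symm
  have hle : (c : WithTop ℝ) ≤ mvalO k α (R - H * G') := by
    have h2 := add_le_mvalO_mul hH.ge hG'le
    rw [add_sub_cancel, coe_le_mvalO_iff] at h2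
    rw [coe_le_mvalO_iff]
    intro J hJ
    rw [coeff_sub] at hJ
    by_cases h : coeff J R = 0
    · exact h2 J fun h' => hJ (by rw [h, h', sub_zero])
    · exact coe_le_mvalO_iff.mp hRI.ge J h
  have hmap : φ (R - H * G') = f := by
    rw [map_sub, (hker (H * G')).mpr (dvd_mul_right _ _), hR, sub_zero]
  have hlt := coe_lt_mvalO hle hcomp
  obtain ⟨J, hJ⟩ := exists_mvalO_eq_weight (α := α) (hne hmap)
  have hmin := hwf.min_le (hT.image _) (Set.mem_image_of_mem _ (show J ∈ T from ⟨_, hmap, hJ⟩))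
  rw [← hImin] at hmin
  rw [hJ] at hlt
  exact absurd (WithTop.coe_lt_coe.mp hlt) (not_lt.mpr (OrderDual.toDual_le_toDual.mp hmin))

/-- The largest valuation of a lift of `f`. -/
def supLift (α : Fin 4 → ℝ) (φ : MvPolynomial (Fin 4) k →+* A) (f : A) : WithTop ℝ :=
  sSup {v | ∃ R : MvPolynomial (Fin 4) k, φ R = f ∧ mvalO k α R = v}

lemma isLUB_supLift (R : MvPolynomial (Fin 4) k) :
    IsLUB {v | ∃ S, φ S = φ R ∧ mvalO k α S = v} (supLift α φ (φ R)) :=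
  WithTop.isLUB_sSup' ⟨_, R, rfl, rfl⟩

lemma mvalO_le_supLift (R : MvPolynomial (Fin 4) k) : mvalO k α R ≤ supLift α φ (φ R) :=
  (isLUB_supLift R).1 ⟨R, rfl, rfl⟩

lemma supLift_zero : supLift α φ 0 = ⊤ :=
  top_le_iff.mp (by simpa [mvalO_zero] using mvalO_le_supLift (α := α) (φ := φ) 0)

lemma supLift_eq (hker : ∀ R, φ R = 0 ↔ H ∣ R) (hH : mvalO k α H = e)
    {c : ℝ} {R : MvPolynomial (Fin 4) k} (hR : mvalO k α R = c)
    (hdvd : ¬ weightedHomogeneousComponent α e H ∣ weightedHomogeneousComponent α c R) :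
    supLift α φ (φ R) = c := by
  refine le_antisymm ((isLUB_supLift R).2 ?_) (hR ▸ mvalO_le_supLift R)
  rintro _ ⟨S, hS, rfl⟩
  exact mvalO_le_of_map_eq hker hH hR hdvd hS

lemma exists_mvalO_eq_supLift (hα : ∀ i, α i < 0) (hφ : Function.Surjective φ)
    (hker : ∀ R, φ R = 0 ↔ H ∣ R) (hH : mvalO k α H = e) (f : A) :
    ∃ R, φ R = f ∧ mvalO k α R = supLift α φ f := by
  by_cases hf : f = 0
  · exact ⟨0, by simp [hf], by rw [hf, supLift_zero, mvalO_zero]⟩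
  · obtain ⟨R, c, rfl, hR, hdvd⟩ := exists_lift_not_dvd hα hφ hker hH hf
    exact ⟨R, rfl, by rw [hR, supLift_eq hker hH hR hdvd]⟩

lemma supLift_mul (hα : ∀ i, α i < 0) (hφ : Function.Surjective φ)
    (hker : ∀ R, φ R = 0 ↔ H ∣ R) (hH : mvalO k α H = e)
    (hprime : Prime (weightedHomogeneousComponent α e H)) (f g : A) :
    supLift α φ (f * g) = supLift α φ f + supLift α φ g := by
  by_cases hf : f = 0
  · simp [hf, supLift_zero]
  by_cases hg : g = 0
  · simp [hg, supLift_zero]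
  obtain ⟨R, a, rfl, hR, hRdvd⟩ := exists_lift_not_dvd hα hφ hker hH hf
  obtain ⟨S, b, rfl, hS, hSdvd⟩ := exists_lift_not_dvd hα hφ hker hH hg
  rw [supLift_eq hker hH hR hRdvd, supLift_eq hker hH hS hSdvd, ← map_mul,
    supLift_eq hker hH (mvalO_mul_eq hR hS), WithTop.coe_add]
  rw [weightedHomogeneousComponent_add_mul hR.ge hS.ge]
  exact hprime.not_dvd_mul hRdvd hSdvd

lemma supLift_eq_top_iff (hα : ∀ i, α i < 0) (hφ : Function.Surjective φ)
    (hker : ∀ R, φ R = 0 ↔ H ∣ R) (hH : mvalO k α H = e) (f : A) :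
    supLift α φ f = ⊤ ↔ f = 0 := by
  refine ⟨fun h => ?_, fun h => h ▸ supLift_zero⟩
  by_contra hf
  obtain ⟨R, c, rfl, hR, hdvd⟩ := exists_lift_not_dvd hα hφ hker hH hf
  rw [supLift_eq hker hH hR hdvd] at h
  exact WithTop.coe_ne_top h

lemma supLift_nonpos (hα : ∀ i, α i < 0) (hφ : Function.Surjective φ)
    (hker : ∀ R, φ R = 0 ↔ H ∣ R) (hH : mvalO k α H = e) {f : A} (hf : f ≠ 0) :
    supLift α φ f ≤ 0 := by
  obtain ⟨R, rfl, hR⟩ := exists_mvalO_eq_supLift hα hφ hker hH f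
  have hR0 : R ≠ 0 := by rintro rfl; exact hf (map_zero φ)
  obtain ⟨I, hI⟩ := exists_mvalO_eq_weight (α := α) hR0
  rw [← hR, hI]
  exact_mod_cast weight_nonpos hα I

lemma min_le_supLift_add (hα : ∀ i, α i < 0) (hφ : Function.Surjective φ)
    (hker : ∀ R, φ R = 0 ↔ H ∣ R) (hH : mvalO k α H = e) (f g : A) :
    min (supLift α φ f) (supLift α φ g) ≤ supLift α φ (f + g) := by
  obtain ⟨R, rfl, hR⟩ := exists_mvalO_eq_supLift hα hφ hker hH f
  obtain ⟨S, rfl, hS⟩ := exists_mvalO_eq_supLift hα hφ hker hH g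
  rw [← hR, ← hS, ← map_add]
  exact (min_le_mvalO_add R S).trans (mvalO_le_supLift _)

lemma supLift_eq_of_isWeightedHomogeneous (hker : ∀ R, φ R = 0 ↔ H ∣ R) (hH : mvalO k α H = e)
    {c : ℝ} {R : MvPolynomial (Fin 4) k} (hR : R.IsWeightedHomogeneous α c)
    (hdvd : ¬ weightedHomogeneousComponent α e H ∣ R) : supLift α φ (φ R) = c := by
  have hcomp := hR.weightedHomogeneousComponent_same
  refine supLift_eq hker hH
    (mvalO_eq_coe_iff.mpr ⟨le_mvalO_of_isWeightedHomogeneous hR, ?_⟩) (by rwa [hcomp])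
  rw [hcomp]
  rintro rfl
  exact hdvd (dvd_zero _)

end Quotient

lemma weightedHomogeneousComponent_X_add_C (hα : ∀ i, α i < 0) (i : Fin 4) (a : k) :
    weightedHomogeneousComponent α (α i) (X i + C a) = X i := by
  rw [map_add, (isWeightedHomogeneous_X k α i).weightedHomogeneousComponent_same,
    (isWeightedHomogeneous_C α a).weightedHomogeneousComponent_ne _ (hα i).ne, add_zero]

lemma le_mvalO_X_add_C (hα : ∀ i, α i < 0) (i : Fin 4) (a : k) :
    ((α i : ℝ) : WithTop ℝ) ≤ mvalO k α (X i + C a) := by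
  refine le_trans (le_min ?_ ?_) (min_le_mvalO_add _ _)
  · exact le_mvalO_of_isWeightedHomogeneous (isWeightedHomogeneous_X k α i)
  · exact le_trans (by exact_mod_cast (hα i).le)
      (le_mvalO_of_isWeightedHomogeneous (isWeightedHomogeneous_C α a))

lemma mvalO_neg (R : MvPolynomial (Fin 4) k) : mvalO k α (-R) = mvalO k α R := by
  simp [mvalO, support_neg]

end MonomialValuation

section Quadric

variable (k : Type) [Field k]

lemma prime_qpoly : Prime (qpoly k) := by
  have hX : Prime (X 0 : MvPolynomial (Fin 4) k) := X_prime
  have hdvd : ∀ i : Fin 4, i ≠ 0 → ¬ (X 0 : MvPolynomial (Fin 4) k) ∣ X i := by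
    intro i hi h
    exact hi (by simpa [eq_comm] using X_dvd_X.mp h)
  have h : Irreducible ((X 0 : MvPolynomial (Fin 4) k) * X 3 + -(X 1 * X 2)) := by
    refine irreducible_mul_X_add _ _ 3 (X_ne_zero 0) (by simp [vars_X]) ?_ ?_
    · intro h
      rw [vars_neg] at h
      simpa [vars_X] using vars_mul _ _ h
    · rw [IsRelPrime.neg_right_iff]
      exact (hX.irreducible.isRelPrime_iff_not_dvd).mpr
        (hX.not_dvd_mul (hdvd 1 (by decide)) (hdvd 2 (by decide)))
  rw [qpoly, sub_eq_add_neg]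
  exact h.prime

variable {k}

/-- Translation of the variables by the point `p`. -/
def translateVars (p : Fin 4 → k) : MvPolynomial (Fin 4) k ≃ₐ[k] MvPolynomial (Fin 4) k :=
  AlgEquiv.ofAlgHom (aeval fun i => X i + C (p i)) (aeval fun i => X i - C (p i))
    (by ext i; simp) (by ext i; simp)

/-- The projection to the coordinate ring of the quadric, in the variables translated by `p`. -/
def translatedProj (p : Fin 4 → k) : MvPolynomial (Fin 4) k →+* QuadRing k :=
  (qmk k).comp ((translateVars p).symm : MvPolynomial (Fin 4) k →+* MvPolynomial (Fin 4) k)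

variable {α : Fin 4 → ℝ}

lemma nuSup_eq_supLift (p : Fin 4 → k) (f : QuadRing k) :
    nuSup k p α f = supLift α (translatedProj p) f := by
  unfold nuSup supLift
  congr 1
  ext v
  constructor
  · rintro ⟨R, hR, rfl⟩
    exact ⟨translateVars p R, by simpa [translatedProj] using hR, rfl⟩
  · rintro ⟨R, hR, rfl⟩
    refine ⟨(translateVars p).symm R, hR, ?_⟩
    change mvalO k α (translateVars p ((translateVars p).symm R)) = _
    rw [AlgEquiv.apply_symm_apply]

lemma qmk_comp_translate_symm_eq_zero_iff (p : Fin 4 → k) (R : MvPolynomial (Fin 4) k) :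
    translatedProj p R = 0 ↔ translateVars p (qpoly k - 1) ∣ R := by
  have h : translatedProj p R = qmk k ((translateVars p).symm R) := rfl
  rw [h, qmk, Ideal.Quotient.eq_zero_iff_mem, Ideal.mem_span_singleton,
    ← map_dvd_iff (translateVars p), AlgEquiv.apply_symm_apply]

lemma translate_qpoly_sub_one (p : Fin 4 → k) :
    translateVars p (qpoly k - 1) = (X 0 + C (p 0)) * (X 3 + C (p 3)) +
      (-((X 1 + C (p 1)) * (X 2 + C (p 2))) + -C 1) := by
  simp only [translateVars, AlgEquiv.ofAlgHom_apply, qpoly, map_sub, map_mul, aeval_X, map_one]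
  ring

lemma weightedHomogeneousComponent_translate_qpoly_sub_one (hα : ∀ i, α i < 0)
    (hsum : α 0 + α 3 = α 1 + α 2) (p : Fin 4 → k) :
    weightedHomogeneousComponent α (α 0 + α 3) (translateVars p (qpoly k - 1)) = qpoly k := by
  rw [translate_qpoly_sub_one, map_add, map_add, map_neg, map_neg,
    weightedHomogeneousComponent_add_mul (le_mvalO_X_add_C hα 0 _) (le_mvalO_X_add_C hα 3 _), hsum,
    weightedHomogeneousComponent_add_mul (le_mvalO_X_add_C hα 1 _) (le_mvalO_X_add_C hα 2 _),
    (isWeightedHomogeneous_C α 1).weightedHomogeneousComponent_ne _ (add_neg (hα 1) (hα 2)).ne]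
  simp only [weightedHomogeneousComponent_X_add_C hα]
  rw [qpoly]
  ring

lemma mvalO_translate_qpoly_sub_one (hα : ∀ i, α i < 0)
    (hsum : α 0 + α 3 = α 1 + α 2) (p : Fin 4 → k) :
    mvalO k α (translateVars p (qpoly k - 1)) = ((α 0 + α 3 : ℝ) : WithTop ℝ) := by
  refine mvalO_eq_coe_iff.mpr ⟨?_, ?_⟩
  · rw [translate_qpoly_sub_one]
    refine le_trans (le_min ?_ (le_trans (le_min ?_ ?_) (min_le_mvalO_add _ _)))
      (min_le_mvalO_add _ _)
    · exact add_le_mvalO_mul (le_mvalO_X_add_C hα 0 _) (le_mvalO_X_add_C hα 3 _)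
    · rw [mvalO_neg, hsum]
      exact add_le_mvalO_mul (le_mvalO_X_add_C hα 1 _) (le_mvalO_X_add_C hα 2 _)
    · rw [mvalO_neg]
      exact le_trans (by exact_mod_cast (add_neg (hα 0) (hα 3)).le)
        (le_mvalO_of_isWeightedHomogeneous (isWeightedHomogeneous_C α 1))
  · rw [weightedHomogeneousComponent_translate_qpoly_sub_one hα hsum]
    exact (prime_qpoly k).ne_zero

end Quadric

/-- Proposition 4.1, first part: for every point `p ∈ k⁴` and weights
`α ∈ (ℝ^{<0})⁴` with `α₀ + α₃ = α₁ + α₂`, the map `ν(f) = sup {ν_p^α(R) : π R = f}` is a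
well-defined valuation on `k[Q]`, takes all its values in `ℝ^{≤0} ∪ {+∞}`, and is
centered at infinity, i.e. `ν(g) < 0` for some `g ∈ k[Q]`. -/
theorem nuSup_isValuation (k : Type) [Field k] [IsAlgClosed k] [CharZero k]
    (p : Fin 4 → k) (α : Fin 4 → ℝ)
    (hα : ∀ i, α i < 0) (hsum : α 0 + α 3 = α 1 + α 2) :
    IsValuation k (QuadRing k) (nuSup k p α) ∧
    (∀ f : QuadRing k, nuSup k p α f ≤ 0 ∨ nuSup k p α f = ⊤) ∧
    (∃ g : QuadRing k, nuSup k p α g < 0) := by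
  have hnu : nuSup k p α = supLift α (translatedProj p) :=
    funext (nuSup_eq_supLift p)
  have hφ : Function.Surjective (translatedProj p) :=
    Ideal.Quotient.mk_surjective.comp (translateVars p).symm.surjective
  have hker := qmk_comp_translate_symm_eq_zero_iff p
  have hH := mvalO_translate_qpoly_sub_one hα hsum p
  have hlead := weightedHomogeneousComponent_translate_qpoly_sub_one hα hsum p
  rw [hnu]
  refine ⟨⟨supLift_eq_top_iff hα hφ hker hH, fun a ha => ?_, ?_, min_le_supLift_add hα hφ hker hH⟩,
    fun f => ?_, ?_⟩
  · have h := supLift_eq_of_isWeightedHomogeneous hker hH (isWeightedHomogeneous_C α a)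
      (by rw [hlead]
          exact fun h => (prime_qpoly k).not_isUnit
            (isUnit_of_dvd_unit h ((isUnit_iff_ne_zero.mpr ha).map C)))
    have hC : translatedProj p (C a) =
        algebraMap k (QuadRing k) a := by
      change qmk k ((translateVars p).symm (algebraMap k _ a)) = _
      rw [AlgEquiv.commutes]
      rfl
    rw [hC] at h
    exact h
  · exact supLift_mul hα hφ hker hH (by rw [hlead]; exact prime_qpoly k)
  · by_cases hf : f = 0
    · exact Or.inr (hf ▸ supLift_zero)
    · exact Or.inl (supLift_nonpos hα hφ hker hH hf)
  · refine ⟨_, (supLift_eq_of_isWeightedHomogeneous hker hH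
      (isWeightedHomogeneous_X k α 0) ?_).trans_lt (by exact_mod_cast hα 0)⟩
    rw [hlead]
    rintro ⟨G, hG⟩
    simpa [qpoly] using congrArg (eval (Pi.single 0 1)) hG
end
end

section
/- Let p = (x0,y0,z0,t0) ∈ k⁴ and α = (α0,α1,α2,α3) with αi < 0 for all i and α0 + α3 = α1 + α2, and let ν : k[Q] → ℝ ∪ {+∞} be defined by ν(0) = +∞ and ν(f) = sup{ν_p^α(R) : R ∈ k[x,y,z,t], π(R) = f} for f ≠ 0. If ν' : k[Q] → ℝ^{≤0} ∪ {+∞} is any valuation satisfying ν'(π(x − x0)) = ν(π(x − x0)), ν'(π(y − y0)) = ν(π(y − y0)), ν'(π(z − z0)) = ν(π(z − z0)) and ν'(π(t − t0)) = ν(π(t − t0)), then ν'(f) ≥ ν(f) for every f ∈ k[Q]. -/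
noncomputable section

open MvPolynomial

namespace IsValuation

variable {k : Type} [Field k] {A : Type} [CommRing A] [Algebra k A] {ν : A → WithTop ℝ}

theorem map_one (h : IsValuation k A ν) : ν 1 = 0 := by
  simpa using h.2.1 1 one_ne_zero

theorem le_map_sum (h : IsValuation k A ν) {ι : Type*} (s : Finset ι) (f : ι → A)
    {c : WithTop ℝ} (hc : ∀ i ∈ s, c ≤ ν (f i)) : c ≤ ν (∑ i ∈ s, f i) := by
  classical
  induction s using Finset.induction_on with
  | empty => simp [(h.1 0).2 rfl]
  | insert a s ha ih =>
    rw [Finset.sum_insert ha]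
    exact (le_min (hc a (Finset.mem_insert_self a s))
      (ih fun i hi => hc i (Finset.mem_insert_of_mem hi))).trans (h.2.2.2 _ _)

theorem map_prod (h : IsValuation k A ν) {ι : Type*} (s : Finset ι) (f : ι → A) :
    ν (∏ i ∈ s, f i) = ∑ i ∈ s, ν (f i) := by
  classical
  induction s using Finset.induction_on with
  | empty => simpa using h.map_one
  | insert a s ha ih => rw [Finset.prod_insert ha, h.2.2.1, Finset.sum_insert ha, ih]

theorem map_pow (h : IsValuation k A ν) (f : A) (n : ℕ) : ν (f ^ n) = n • ν f := by
  induction n with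
  | zero => simpa using h.map_one
  | succ n ih => rw [pow_succ, h.2.2.1, ih, succ_nsmul]

/-- A valuation is bounded below on polynomial expressions by the monomial valuation whose
weights are lower bounds for the values of the generators. -/
theorem inf_le_map_aeval (h : IsValuation k A ν) {σ : Type*} [Fintype σ] (α : σ → ℝ)
    (g : σ → A) (hg : ∀ i, (α i : WithTop ℝ) ≤ ν (g i)) (S : MvPolynomial σ k) :
    (S.support.inf fun I => ((∑ i, α i * (I i : ℝ) : ℝ) : WithTop ℝ)) ≤ ν (aeval g S) := by
  rw [aeval_def, eval₂_eq']
  refine h.le_map_sum _ _ fun I hI => (Finset.inf_le hI).trans ?_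
  rw [h.2.2.1, h.2.1 _ (mem_support_iff.1 hI), zero_add, h.map_prod, WithTop.coe_sum]
  refine Finset.sum_le_sum fun i _ => ?_
  rw [h.map_pow]
  calc ((α i * (I i : ℝ) : ℝ) : WithTop ℝ) = I i • (α i : WithTop ℝ) := by
        rw [← WithTop.coe_nsmul, nsmul_eq_mul, mul_comm]
    _ ≤ I i • ν (g i) := nsmul_le_nsmul_right (hg i) _

end IsValuation

section

variable (k : Type) [Field k] (p : Fin 4 → k) (α : Fin 4 → ℝ)

theorem isLUB_nuSup (f : QuadRing k) :
    IsLUB {v : WithTop ℝ | ∃ R : MvPolynomial (Fin 4) k, qmk k R = f ∧ mvalP k p α R = v}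
      (nuSup k p α f) := by
  obtain ⟨R, hR⟩ := Ideal.Quotient.mk_surjective f
  exact WithTop.isLUB_sSup' ⟨_, R, hR, rfl⟩

theorem mvalP_X_sub_C (i : Fin 4) : mvalP k p α (X i - C (p i)) = α i := by
  simp [mvalP, support_X, Finsupp.single_apply]

theorem le_nuSup_X_sub_C (i : Fin 4) : (α i : WithTop ℝ) ≤ nuSup k p α (qmk k (X i - C (p i))) :=
  (isLUB_nuSup k p α _).1 ⟨_, rfl, mvalP_X_sub_C k p α i⟩

theorem aeval_qmk_aeval_add_C (R : MvPolynomial (Fin 4) k) :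
    aeval (fun i => qmk k (X i - C (p i)))
      (aeval (fun i => X i + C (p i)) R : MvPolynomial (Fin 4) k) = qmk k R := by
  have key : ((aeval fun i => qmk k (X i - C (p i))).comp
      (aeval fun i => (X i + C (p i) : MvPolynomial (Fin 4) k))) =
      Ideal.Quotient.mkₐ k (Ideal.span {qpoly k - 1}) := by
    ext i
    have hC : algebraMap k (QuadRing k) (p i) = qmk k (C (p i)) := rfl
    simp [hC]
    rfl
  exact DFunLike.congr_fun key R

end

/-- Proposition 4.1, minimality: if `ν'` is any valuation on `k[Q]`
with values in `ℝ^{≤0} ∪ {+∞}` agreeing with `ν = nuSup p α` on the classes of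
`x - x₀, y - y₀, z - z₀, t - t₀`, then `ν'(f) ≥ ν(f)` for every `f ∈ k[Q]`. -/
theorem nuSup_minimal (k : Type) [Field k] [IsAlgClosed k] [CharZero k]
    (p : Fin 4 → k) (α : Fin 4 → ℝ)
    (hα : ∀ i, α i < 0) (hsum : α 0 + α 3 = α 1 + α 2)
    (ν' : QuadRing k → WithTop ℝ)
    (hval : IsValuation k (QuadRing k) ν')
    (hneg : ∀ f : QuadRing k, ν' f ≤ 0 ∨ ν' f = ⊤)
    (hx : ν' (qmk k (X 0 - C (p 0))) = nuSup k p α (qmk k (X 0 - C (p 0))))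
    (hy : ν' (qmk k (X 1 - C (p 1))) = nuSup k p α (qmk k (X 1 - C (p 1))))
    (hz : ν' (qmk k (X 2 - C (p 2))) = nuSup k p α (qmk k (X 2 - C (p 2))))
    (ht : ν' (qmk k (X 3 - C (p 3))) = nuSup k p α (qmk k (X 3 - C (p 3)))) :
    ∀ f : QuadRing k, nuSup k p α f ≤ ν' f := by
  have hg : ∀ i, (α i : WithTop ℝ) ≤ ν' (qmk k (X i - C (p i))) := by
    intro i
    refine (le_nuSup_X_sub_C k p α i).trans_eq ?_
    fin_cases i
    exacts [hx.symm, hy.symm, hz.symm, ht.symm]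
  intro f
  refine (isLUB_nuSup k p α f).2 ?_
  rintro _ ⟨R, rfl, rfl⟩
  rw [← aeval_qmk_aeval_add_C k p R]
  exact hval.inf_le_map_aeval α _ hg _
end
end

section
/- Let α = (α0,α1,α2,α3) with αi < 0 for all i and α0 + α3 = α1 + α2, and let ν' := ν_0^α be the monomial valuation on k[x,y,z,t] at the origin with weights α. For a nonzero polynomial R = Σ a_{ijmn} x^i y^j z^m t^n ∈ k[x,y,z,t], set R^w := Σ over those (i,j,m,n) with i·α0 + j·α1 + m·α2 + n·α3 = ν'(R), of a_{ijmn} x^i y^j z^m t^n. Then the following are equivalent: (i) there exists R1 ∈ k[x,y,z,t] with π(R1) = π(R) in k[Q] and ν'(R1) > ν'(R); (ii) the polynomial q = xt − yz divides R^w. -/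
noncomputable section

open MvPolynomial

namespace MvPolynomial.IsWeightedHomogeneous

/-- Multiplying by a weighted homogeneous polynomial shifts weighted homogeneous components. -/
theorem weightedHomogeneousComponent_mul {R σ M : Type*} [CommSemiring R] [AddCommGroup M]
    {w : σ → M} {d : M} {p : MvPolynomial σ R} (hp : IsWeightedHomogeneous w p d) (n : M)
    (f : MvPolynomial σ R) :
    weightedHomogeneousComponent w n (p * f) = p * weightedHomogeneousComponent w (n - d) f := by
  classical
  let _ := weightedGradedAlgebra R w
  have h := DirectSum.coe_decompose_mul_add_of_left_mem (weightedHomogeneousSubmodule R w)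
    (j := n - d) (b := f) ((mem_weightedHomogeneousSubmodule R w d p).2 hp)
  rw [add_sub_cancel] at h
  rw [← weightedDecomposition.decompose'_apply, ← weightedDecomposition.decompose'_apply]
  exact h

end MvPolynomial.IsWeightedHomogeneous

theorem qpoly_isWeightedHomogeneous (k : Type) [Field k] {α : Fin 4 → ℝ}
    (hsum : α 0 + α 3 = α 1 + α 2) :
    IsWeightedHomogeneous α (qpoly k) (α 0 + α 3) :=
  ((isWeightedHomogeneous_X k α 0).mul (isWeightedHomogeneous_X k α 3)).sub
    (hsum ▸ (isWeightedHomogeneous_X k α 1).mul (isWeightedHomogeneous_X k α 2))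

theorem qpoly_ne_zero (k : Type) [Field k] : qpoly k ≠ 0 := by
  intro h
  have := congrArg (eval ![1, 0, 0, 1]) h
  simp [qpoly] at this

theorem weight_eq_sum (α : Fin 4 → ℝ) (I : Fin 4 →₀ ℕ) :
    Finsupp.weight α I = ∑ i, α i * (I i : ℝ) := by
  simp [Finsupp.weight_apply, Finsupp.sum_fintype, mul_comm]

theorem coe_lt_mvalO_iff {k : Type} [Field k] {α : Fin 4 → ℝ} {r : ℝ}
    {f : MvPolynomial (Fin 4) k} :
    (r : WithTop ℝ) < mvalO k α f ↔ ∀ n ≤ r, weightedHomogeneousComponent α n f = 0 := by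
  classical
  rw [mvalO, Finset.lt_inf_iff (WithTop.coe_lt_top r)]
  simp only [WithTop.coe_lt_coe, ← weight_eq_sum]
  constructor
  · intro h n hn
    exact weightedHomogeneousComponent_eq_zero' n f fun I hI => (hn.trans_lt (h I hI)).ne'
  · intro h I hI
    by_contra! hle
    have := congrArg (coeff I) (h _ hle)
    rw [coeff_weightedHomogeneousComponent, if_pos rfl, coeff_zero] at this
    exact mem_support_iff.1 hI this

theorem exists_mvalO_eq_coe {k : Type} [Field k] (α : Fin 4 → ℝ)
    {f : MvPolynomial (Fin 4) k} (hf : f ≠ 0) : ∃ m : ℝ, mvalO k α f = m := by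
  obtain ⟨I, -, hI⟩ := Finset.exists_mem_eq_inf f.support (support_nonempty.2 hf)
    fun I => ((∑ i, α i * (I i : ℝ) : ℝ) : WithTop ℝ)
  exact ⟨_, hI⟩

theorem leadPart4_eq_weightedHomogeneousComponent {k : Type} [Field k] {α : Fin 4 → ℝ}
    {f : MvPolynomial (Fin 4) k} {m : ℝ} (hm : mvalO k α f = m) :
    leadPart4 k α f = weightedHomogeneousComponent α m f := by
  classical
  rw [leadPart4, weightedHomogeneousComponent_apply]
  refine Finset.sum_congr (Finset.filter_congr fun I _ => ?_) fun _ _ => rfl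
  rw [hm, WithTop.coe_eq_coe, weight_eq_sum]

/-- If in all degrees below `m` the components of `f` are obtained from those of degree larger by
`-d > 0` upon multiplication by a nonzero `p`, then the component of degree `m` vanishes. -/
theorem weightedHomogeneousComponent_eq_zero_of_shift {k σ : Type*} [Field k] {w : σ → ℝ}
    {p f : MvPolynomial σ k} {d m : ℝ} (hp : p ≠ 0) (hd : d < 0)
    (h : ∀ n < m, weightedHomogeneousComponent w n f =
      p * weightedHomogeneousComponent w (n - d) f) :
    weightedHomogeneousComponent w m f = 0 := by
  by_contra hm
  have hne : ∀ j : ℕ, weightedHomogeneousComponent w (m + j * d) f ≠ 0 := by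
    intro j
    induction j with
    | zero => simpa using hm
    | succ j ih =>
      have hlt : m + (j + 1 : ℕ) * d < m := by
        push_cast
        nlinarith [Nat.cast_nonneg (α := ℝ) j]
      rw [h _ hlt, show m + (j + 1 : ℕ) * d - d = m + j * d by push_cast; ring]
      exact mul_ne_zero hp ih
  have hinj : Function.Injective fun j : ℕ => m + j * d := fun i j hij => by
    simpa [hd.ne] using hij
  exact Set.infinite_of_injective_forall_mem hinj hne (weightedHomogeneousComponent_finsupp f)

/-- Lemma 4.6: with `ν' = ν_0^α` the monomial valuation at the origin
(`α_i < 0`, `α₀ + α₃ = α₁ + α₂`), for a nonzero `R ∈ k[x,y,z,t]` the following are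
equivalent: (i) there exists `R₁` with `π R₁ = π R` and `ν'(R₁) > ν'(R)`;
(ii) `q = xt - yz` divides the `α`-leading part `R^w` of `R`. -/
theorem exists_better_lift_iff_q_dvd_leadPart (k : Type) [Field k] [IsAlgClosed k]
    [CharZero k] (α : Fin 4 → ℝ)
    (hα : ∀ i, α i < 0) (hsum : α 0 + α 3 = α 1 + α 2)
    (R : MvPolynomial (Fin 4) k) (hR : R ≠ 0) :
    (∃ R1 : MvPolynomial (Fin 4) k, qmk k R1 = qmk k R ∧ mvalO k α R < mvalO k α R1) ↔
    qpoly k ∣ leadPart4 k α R := by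
  obtain ⟨m, hm⟩ := exists_mvalO_eq_coe α hR
  have hd : α 0 + α 3 < 0 := add_neg (hα 0) (hα 3)
  have hq := qpoly_isWeightedHomogeneous k hsum
  have hlow : ∀ n < m, weightedHomogeneousComponent α n R = 0 := fun n hn =>
    coe_lt_mvalO_iff.1 (hm ▸ WithTop.coe_lt_coe.2 hn) n le_rfl
  rw [leadPart4_eq_weightedHomogeneousComponent hm, hm]
  constructor
  · rintro ⟨R1, hR1, hlt⟩
    obtain ⟨H, hH⟩ := Ideal.mem_span_singleton.1 (Ideal.Quotient.eq.1 hR1)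
    have hcomp : ∀ n ≤ m, weightedHomogeneousComponent α n R =
        weightedHomogeneousComponent α n H -
          qpoly k * weightedHomogeneousComponent α (n - (α 0 + α 3)) H := by
      intro n hn
      have hRe : R = R1 - qpoly k * H + H := by linear_combination -hH
      rw [hRe, map_add, map_sub, coe_lt_mvalO_iff.1 hlt n hn,
        hq.weightedHomogeneousComponent_mul]
      ring
    have hHm : weightedHomogeneousComponent α m H = 0 :=
      weightedHomogeneousComponent_eq_zero_of_shift (qpoly_ne_zero k) hd fun n hn =>
        sub_eq_zero.1 ((hcomp n hn.le).symm.trans (hlow n hn))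
    rw [hcomp m le_rfl, hHm, zero_sub]
    exact (dvd_mul_right _ _).neg_right
  · rintro ⟨S, hS⟩
    set T := weightedHomogeneousComponent α (m - (α 0 + α 3)) S
    have hT : IsWeightedHomogeneous α T (m - (α 0 + α 3)) :=
      weightedHomogeneousComponent_isWeightedHomogeneous _ _
    have hqT : weightedHomogeneousComponent α m R = qpoly k * T := by
      rw [← hq.weightedHomogeneousComponent_mul, ← hS,
        (weightedHomogeneousComponent_isWeightedHomogeneous m R).weightedHomogeneousComponent_same]
    refine ⟨R - (qpoly k * T - T), ?_, coe_lt_mvalO_iff.2 fun n hn => ?_⟩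
    · refine Ideal.Quotient.eq.2 (Ideal.mem_span_singleton.2 ⟨-T, ?_⟩)
      ring
    · rw [map_sub, map_sub, hq.weightedHomogeneousComponent_mul,
        hT.weightedHomogeneousComponent_ne n (by linarith), sub_zero]
      rcases hn.lt_or_eq with hn | rfl
      · rw [hlow n hn, hT.weightedHomogeneousComponent_ne _ (by linarith), mul_zero, sub_zero]
      · rw [hT.weightedHomogeneousComponent_same, hqT, sub_self]
end
end

section
/- For any two elements f1, f2 ∈ k[Q] that are algebraically independent over k, at least one of the four pseudo-jacobians j(x,f1,f2), j(y,f1,f2), j(z,f1,f2), j(t,f1,f2) is not the zero element of k[Q]. -/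
noncomputable section

open MvPolynomial

/-- A prime ideal can be chosen so that a given algebraically independent family stays
algebraically independent in the residue domain. -/
theorem exists_prime_algebraicIndependent_quotient {ι k A : Type*} [Field k] [CommRing A]
    [Algebra k A] {f : ι → A} (hf : AlgebraicIndependent k f) :
    ∃ p : Ideal A, p.IsPrime ∧ AlgebraicIndependent k fun i => Ideal.Quotient.mkₐ k p (f i) := by
  have hdisj : Disjoint ((⊥ : Ideal A) : Set A)
      ((nonZeroDivisors (MvPolynomial ι k)).map (aeval f : MvPolynomial ι k →ₐ[k] A)) := by
    rw [Set.disjoint_left]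
    rintro a ha ⟨P, hP, rfl⟩
    exact nonZeroDivisors.ne_zero hP (hf.eq_zero_of_aeval_eq_zero P (by simpa using ha))
  obtain ⟨p, hp, -, hpS⟩ := Ideal.exists_le_prime_disjoint _ _ hdisj
  refine ⟨p, hp, ?_⟩
  rw [algebraicIndependent_iff]
  intro P hP
  by_contra hne
  have hcomp : aeval (fun i => Ideal.Quotient.mkₐ k p (f i)) P
      = Ideal.Quotient.mkₐ k p (aeval f P) := by
    rw [← comp_aeval_apply]
  rw [hcomp, Ideal.Quotient.mkₐ_eq_mk, Ideal.Quotient.eq_zero_iff_mem] at hP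
  exact Set.disjoint_left.mp hpS hP ⟨P, mem_nonZeroDivisors_of_ne_zero hne, rfl⟩

/-- In characteristic zero, a derivation of a finitely generated field extension may be
prescribed arbitrarily on an algebraically independent family. -/
theorem AlgebraicIndependent.exists_derivation {ι k K : Type*} [Field k] [CharZero k] [Field K]
    [Algebra k K] [Algebra.EssFiniteType k K] {v : ι → K} (hv : AlgebraicIndependent k v)
    (c : ι → K) : ∃ D : Derivation k K K, ∀ i, D (v i) = c i := by
  let _ : Algebra (MvPolynomial ι k) K := (aeval v : MvPolynomial ι k →ₐ[k] K).toAlgebra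
  have halg : ∀ P : MvPolynomial ι k, algebraMap (MvPolynomial ι k) K P = aeval v P :=
    fun _ => rfl
  have : IsScalarTower k (MvPolynomial ι k) K :=
    .of_algebraMap_eq fun r => by
      rw [halg, MvPolynomial.algebraMap_eq, aeval_C]
  have : FaithfulSMul (MvPolynomial ι k) K :=
    (faithfulSMul_iff_algebraMap_injective _ _).mpr hv
  let F := FractionRing (MvPolynomial ι k)
  let _ : Algebra F K := FractionRing.liftAlgebra _ _
  have : IsScalarTower k F K := IsScalarTower.to₁₃₄ k (MvPolynomial ι k) F K
  have : CharZero F := charZero_of_injective_algebraMap (algebraMap k F).injective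
  have : Algebra.EssFiniteType F K := .of_comp k F K
  have : Algebra.FormallySmooth (MvPolynomial ι k) F :=
    .of_isLocalization (nonZeroDivisors (MvPolynomial ι k))
  have : Algebra.FormallySmooth (MvPolynomial ι k) K := .comp _ F _
  have hinj : LinearMap.ker (KaehlerDifferential.mapBaseChange k (MvPolynomial ι k) K) = ⊥ := by
    rw [LinearMap.ker_eq_bot']
    intro x hx
    obtain ⟨x, rfl⟩ := (Algebra.H1Cotangent.exact_δ_mapBaseChange k (MvPolynomial ι k) K x).mp hx
    rw [Subsingleton.elim x 0, map_zero]
  obtain ⟨g, hg⟩ := LinearMap.exists_leftInverse_of_injective _ hinj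
  let d : Derivation k (MvPolynomial ι k) K := mkDerivation k c
  refine ⟨((LinearMap.liftBaseChange K d.liftKaehlerDifferential).comp g).compDer
    (KaehlerDifferential.D k K), fun i => ?_⟩
  have hX : KaehlerDifferential.D k K (v i) = KaehlerDifferential.mapBaseChange k
      (MvPolynomial ι k) K (1 ⊗ₜ KaehlerDifferential.D k (MvPolynomial ι k) (X i)) := by
    rw [KaehlerDifferential.mapBaseChange_tmul, one_smul, KaehlerDifferential.map_D, halg, aeval_X]
  have hgX := LinearMap.congr_fun hg (1 ⊗ₜ KaehlerDifferential.D k (MvPolynomial ι k) (X i))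
  simp only [LinearMap.comp_apply, LinearMap.id_apply] at hgX
  change LinearMap.liftBaseChange K d.liftKaehlerDifferential (g (KaehlerDifferential.D k K (v i)))
    = c i
  rw [hX, hgX]
  simp [d]

/-- The chain rule for a derivation along an evaluation of polynomials. -/
theorem Derivation.map_algHom_mvPolynomial {σ k K : Type*} [Fintype σ] [Field k] [Field K]
    [Algebra k K] (D : Derivation k K K) (φ : MvPolynomial σ k →ₐ[k] K) (R : MvPolynomial σ k) :
    D (φ R) = ∑ i, φ (pderiv i R) * D (φ (X i)) := by
  induction R using MvPolynomial.induction_on with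
  | C a => simp [← MvPolynomial.algebraMap_eq, -map_mul]
  | add p q hp hq => simp [hp, hq, add_mul, Finset.sum_add_distrib]
  | mul_X p i hp =>
    classical
    simp only [map_mul, Derivation.leibniz, smul_eq_mul, hp, pderiv_X, map_add, add_mul,
      Finset.sum_add_distrib, Finset.mul_sum]
    congr 1
    · simp [Pi.single_apply, apply_ite]
    · exact Finset.sum_congr rfl fun j _ => by ring

/-- Three linearly independent vectors in a four-dimensional space are completed to a basis by
some standard basis vector. -/
theorem exists_det_single_ne_zero {K : Type*} [Field K] {u v w : Fin 4 → K}
    (h : LinearIndependent K ![u, v, w]) :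
    ∃ i, (Matrix.of ![u, Pi.single i 1, v, w]).det ≠ 0 := by
  obtain ⟨i, hi⟩ : ∃ i, (Pi.single i 1 : Fin 4 → K) ∉
      Submodule.span K (Set.range ![u, v, w]) := by
    by_contra! hall
    have htop : Submodule.span K (Set.range ![u, v, w]) = ⊤ := by
      rw [eq_top_iff, ← (Pi.basisFun K (Fin 4)).span_eq, Submodule.span_le]
      rintro _ ⟨i, rfl⟩
      simpa using hall i
    have hcard := finrank_span_eq_card h
    rw [htop, finrank_top] at hcard
    simp at hcard
  refine ⟨i, ?_⟩
  have hcons : LinearIndependent K (Fin.cons (Pi.single i 1) ![u, v, w] : Fin 4 → Fin 4 → K) :=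
    linearIndependent_finCons.mpr ⟨h, hi⟩
  have hswap := hcons.comp (Equiv.swap (0 : Fin 4) 1) (Equiv.injective _)
  have heq : (Fin.cons (Pi.single i 1) ![u, v, w] : Fin 4 → Fin 4 → K) ∘ Equiv.swap (0 : Fin 4) 1
      = (Matrix.of ![u, Pi.single i 1, v, w]).row := by
    funext a
    fin_cases a <;> rfl
  rw [heq, Matrix.linearIndependent_rows_iff_isUnit, Matrix.isUnit_iff_isUnit_det] at hswap
  exact hswap.ne_zero

/-- Three vectors admitting a triangular family of dual vectors are linearly independent. -/
theorem linearIndependent_of_dotProduct {n K : Type*} [Fintype n] [Field K]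
    {u v w e d₁ d₂ : n → K}
    (hue : ∑ i, u i * e i = 1) (hu₁ : ∑ i, u i * d₁ i = 0) (hu₂ : ∑ i, u i * d₂ i = 0)
    (hv₁ : ∑ i, v i * d₁ i = 1) (hv₂ : ∑ i, v i * d₂ i = 0)
    (hw₁ : ∑ i, w i * d₁ i = 0) (hw₂ : ∑ i, w i * d₂ i = 1) :
    LinearIndependent K ![u, v, w] := by
  rw [Fintype.linearIndependent_iff]
  intro g hg
  have key : ∀ d : n → K, g 0 * ∑ i, u i * d i + g 1 * ∑ i, v i * d i
      + g 2 * ∑ i, w i * d i = 0 := by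
    intro d
    have h := congrArg (fun s : n → K => ∑ i, s i * d i) hg
    simpa [Fin.sum_univ_three, add_mul, Finset.sum_add_distrib, Finset.mul_sum, mul_assoc] using h
  have g1 : g 1 = 0 := by simpa [hu₁, hv₁, hw₁] using key d₁
  have g2 : g 2 = 0 := by simpa [hu₂, hv₂, hw₂] using key d₂
  have g0 : g 0 = 0 := by simpa [hue, g1, g2] using key e
  intro i
  fin_cases i <;> assumption

/-- The Jacobian criterion over a field-valued point `φ` of the quadric `q = 1`. -/
theorem exists_map_jac_ne_zero {k : Type} {K : Type*} [Field k] [CharZero k] [Field K]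
    [Algebra k K] [Algebra.EssFiniteType k K] (φ : MvPolynomial (Fin 4) k →ₐ[k] K)
    (hq : φ (qpoly k) = 1) {R1 R2 : MvPolynomial (Fin 4) k}
    (hind : AlgebraicIndependent k ![φ R1, φ R2]) :
    ∃ i, φ (jac k ![qpoly k, X i, R1, R2]) ≠ 0 := by
  obtain ⟨D₁, hD₁⟩ := hind.exists_derivation ![1, 0]
  obtain ⟨D₂, hD₂⟩ := hind.exists_derivation ![0, 1]
  have chain (D : Derivation k K K) (R : MvPolynomial (Fin 4) k) :=
    (D.map_algHom_mvPolynomial φ R).symm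
  have hue : ∑ i, φ (pderiv i (qpoly k)) * ![φ (X 0), φ (X 1), 0, 0] i = 1 := by
    rw [← hq]
    simp [qpoly, Fin.sum_univ_four, pderiv_X, Pi.single_apply]
    ring
  have hlin : LinearIndependent K ![fun i => φ (pderiv i (qpoly k)), fun i => φ (pderiv i R1),
      fun i => φ (pderiv i R2)] :=
    linearIndependent_of_dotProduct (d₁ := fun i => D₁ (φ (X i))) (d₂ := fun i => D₂ (φ (X i)))
      hue (by simp [chain, hq]) (by simp [chain, hq])
      ((chain D₁ R1).trans (hD₁ 0)) ((chain D₂ R1).trans (hD₂ 0))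
      ((chain D₁ R2).trans (hD₁ 1)) ((chain D₂ R2).trans (hD₂ 1))
  obtain ⟨i, hi⟩ := exists_det_single_ne_zero hlin
  refine ⟨i, fun h => hi ?_⟩
  rw [← h, jac, AlgHom.map_det]
  congr 1
  ext a j : 2
  obtain rfl | hij := eq_or_ne i j
  · fin_cases a <;> simp [pderiv_X]
  · fin_cases a <;> simp [pderiv_X, hij, hij.symm]

/-- Lemma 4.10: if `f₁, f₂ ∈ k[Q]` are algebraically independent over
`k`, then at least one of the four pseudo-jacobians `j(x,f₁,f₂)`, `j(y,f₁,f₂)`,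
`j(z,f₁,f₂)`, `j(t,f₁,f₂)` is not zero in `k[Q]` (here `Rᵢ` are any lifts of `fᵢ`). -/
theorem pseudoJacobian_ne_zero (k : Type) [Field k] [IsAlgClosed k] [CharZero k]
    (f1 f2 : QuadRing k)
    (hind : AlgebraicIndependent k ![f1, f2])
    (R1 R2 : MvPolynomial (Fin 4) k)
    (h1 : qmk k R1 = f1) (h2 : qmk k R2 = f2) :
    qmk k (jac k ![qpoly k, X 0, R1, R2]) ≠ 0 ∨
    qmk k (jac k ![qpoly k, X 1, R1, R2]) ≠ 0 ∨
    qmk k (jac k ![qpoly k, X 2, R1, R2]) ≠ 0 ∨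
    qmk k (jac k ![qpoly k, X 3, R1, R2]) ≠ 0 := by
  obtain ⟨p, hp, hpind⟩ := exists_prime_algebraicIndependent_quotient hind
  let L := FractionRing (QuadRing k ⧸ p)
  let ψ : QuadRing k →ₐ[k] L :=
    (IsScalarTower.toAlgHom k (QuadRing k ⧸ p) L).comp (Ideal.Quotient.mkₐ k p)
  let φ : MvPolynomial (Fin 4) k →ₐ[k] L :=
    ψ.comp (Ideal.Quotient.mkₐ k (Ideal.span {qpoly k - 1}))
  have hφ (R : MvPolynomial (Fin 4) k) : φ R = ψ (qmk k R) := rfl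
  have hq : φ (qpoly k) = 1 := by
    have h : qmk k (qpoly k) = qmk k 1 :=
      Ideal.Quotient.eq.mpr (Ideal.mem_span_singleton_self _)
    rw [hφ, h, map_one, map_one]
  have hL : AlgebraicIndependent k ![φ R1, φ R2] := by
    have h := hpind.map' (f := IsScalarTower.toAlgHom k (QuadRing k ⧸ p) L)
      (IsFractionRing.injective (QuadRing k ⧸ p) L)
    convert h using 1
    funext i
    fin_cases i
    · simp [hφ, h1, ψ]
    · simp [hφ, h2, ψ]
  have : Algebra.EssFiniteType (QuadRing k ⧸ p) L := .of_isLocalization _ (nonZeroDivisors _)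
  have : Algebra.EssFiniteType k L := .comp k (QuadRing k ⧸ p) L
  obtain ⟨i, hi⟩ := exists_map_jac_ne_zero φ hq hL
  have hne : qmk k (jac k ![qpoly k, X i, R1, R2]) ≠ 0 := fun h => hi (by rw [hφ, h, map_zero])
  fin_cases i
  · exact .inl hne
  · exact .inr (.inl hne)
  · exact .inr (.inr (.inl hne))
  · exact .inr (.inr (.inr hne))
end
end

section
/- Let μ be a valuation on k[X,Y] taking values in ℝ^{≤0} ∪ {+∞} with μ(X) < 0 and μ(Y) < 0, and let μ0 be the monomial valuation on k[X,Y] with weights (μ(X), μ(Y)). If μ ≠ μ0, then there exist coprime positive integers s1, s2 with s1·μ(X) = s2·μ(Y), and a unique constant λ ∈ k — necessarily nonzero — such that the polynomial H := X^{s1} − λ·Y^{s2} satisfies μ(H) > μ0(H) = s1·μ(X). -/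
noncomputable section

open MvPolynomial

lemma addValuation_monomial {k : Type} [Field k] (v : AddValuation (MvPolynomial (Fin 2) k) (WithTop ℝ))
    (hC : ∀ c : k, c ≠ 0 → v (C c) = 0) {a b : ℝ} (ha : v (X 0) = a) (hb : v (X 1) = b)
    (I : Fin 2 →₀ ℕ) {c : k} (hc : c ≠ 0) :
    v (monomial I c) = ((∑ i, ![a, b] i * (I i : ℝ) : ℝ) : WithTop ℝ) := by
  rw [monomial_eq, Finsupp.prod_fintype _ _ (by simp)]
  simp only [Fin.prod_univ_two, Fin.sum_univ_two, AddValuation.map_mul, AddValuation.map_pow,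
    ha, hb, hC c hc, zero_add, Matrix.cons_val_zero, Matrix.cons_val_one]
  rw [← WithTop.coe_nsmul, ← WithTop.coe_nsmul, ← WithTop.coe_add]
  simp [nsmul_eq_mul, mul_comm]

/-- A valuation different from the monomial valuation jumps on some nonzero weighted-homogeneous
polynomial. -/
lemma exists_weightedHomogeneous_lt_addValuation {k : Type} [Field k]
    (v : AddValuation (MvPolynomial (Fin 2) k) (WithTop ℝ))
    (hC : ∀ c : k, c ≠ 0 → v (C c) = 0) {a b : ℝ} (ha : v (X 0) = a) (hb : v (X 1) = b)
    {R : MvPolynomial (Fin 2) k} (hR : v R ≠ mval2 k ![a, b] R) :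
    ∃ (L : MvPolynomial (Fin 2) k) (d : ℝ), L ≠ 0 ∧
      (∀ I ∈ L.support, ∑ i, ![a, b] i * (I i : ℝ) = d) ∧ (d : WithTop ℝ) < v L := by
  classical
  set w : (Fin 2 →₀ ℕ) → ℝ := fun I => ∑ i, ![a, b] i * (I i : ℝ) with hw
  have hmon : ∀ I ∈ R.support, v (monomial I (R.coeff I)) = (w I : WithTop ℝ) := fun I hI =>
    addValuation_monomial v hC ha hb I (mem_support_iff.mp hI)
  have hR0 : R ≠ 0 := by
    rintro rfl
    exact hR (by simp [mval2])
  obtain ⟨I₀, hI₀, hinf⟩ := Finset.exists_mem_eq_inf R.support (support_nonempty.mpr hR0)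
    (fun I => (w I : WithTop ℝ))
  have hinf' : mval2 k ![a, b] R = (w I₀ : WithTop ℝ) := hinf
  have hle : ∀ I ∈ R.support, w I₀ ≤ w I := fun I hI => by
    have := Finset.inf_le (f := fun I => (w I : WithTop ℝ)) hI
    rw [hinf] at this
    exact WithTop.coe_le_coe.mp this
  have hvR : (w I₀ : WithTop ℝ) < v R := by
    refine lt_of_le_of_ne ?_ (fun h => hR (by rw [hinf', h]))
    conv_rhs => rw [R.as_sum]
    refine v.map_le_sum fun I hI => ?_
    rw [hmon I hI]
    exact WithTop.coe_le_coe.mpr (hle I hI)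
  set L := ∑ I ∈ R.support with w I = w I₀, monomial I (R.coeff I) with hL
  have hcoeff : ∀ J, coeff J L = if J ∈ R.support.filter (fun I => w I = w I₀)
      then R.coeff J else 0 := fun J => by
    simp only [hL, coeff_sum, coeff_monomial, Finset.sum_ite_eq']
  refine ⟨L, w I₀, fun h => ?_, fun I hI => ?_, ?_⟩
  · have := hcoeff I₀
    rw [h, if_pos (by simpa using hI₀)] at this
    exact mem_support_iff.mp hI₀ (by simpa using this.symm)
  · rw [mem_support_iff, hcoeff] at hI
    exact (Finset.mem_filter.mp (ite_ne_right_iff.mp hI).1).2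
  · have hsplit : L = R - ∑ I ∈ R.support with ¬ w I = w I₀, monomial I (R.coeff I) := by
      rw [eq_sub_iff_add_eq, hL, Finset.sum_filter_add_sum_filter_not, ← R.as_sum]
    rw [hsplit, sub_eq_add_neg]
    refine v.map_lt_add hvR ?_
    rw [v.map_neg]
    refine v.map_lt_sum WithTop.coe_ne_top fun I hI => ?_
    obtain ⟨hI, hne⟩ := Finset.mem_filter.mp hI
    rw [hmon I hI]
    exact WithTop.coe_lt_coe.mpr (lt_of_le_of_ne (hle I hI) (Ne.symm hne))

/-- If no `U - λ V` jumps, then no homogeneous form in `U`, `V` jumps. -/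
lemma addValuation_aeval_homogenize_le {k : Type} [Field k] [IsAlgClosed k] {A : Type*} [CommRing A] [Algebra k A]
    (v : AddValuation A (WithTop ℝ)) (hC : ∀ c : k, c ≠ 0 → v (algebraMap k A c) = 0)
    {U V : A} {c : WithTop ℝ} (hV : v V ≤ c)
    (hUV : ∀ l : k, v (U - algebraMap k A l * V) ≤ c) (n : ℕ) :
    ∀ p : Polynomial k, p ≠ 0 → p.natDegree ≤ n →
      v (aeval ![U, V] (p.homogenize n)) ≤ n • c := by
  have hdeg0 : ∀ (m : ℕ) (p : Polynomial k), p ≠ 0 → p.natDegree = 0 →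
      v (aeval ![U, V] (p.homogenize m)) ≤ m • c := by
    intro m p hp hdeg
    rw [Polynomial.eq_C_of_natDegree_eq_zero hdeg] at hp ⊢
    simp only [Polynomial.homogenize_C, map_mul, map_pow, algHom_C, aeval_X,
      Matrix.cons_val_one, AddValuation.map_mul, AddValuation.map_pow]
    rw [hC _ (by simpa using hp), zero_add]
    exact nsmul_le_nsmul_right hV m
  induction n with
  | zero => exact fun p hp hdeg => hdeg0 0 p hp (Nat.le_zero.mp hdeg)
  | succ n ih =>
    intro p hp hdeg
    by_cases h0 : p.natDegree = 0
    · exact hdeg0 _ p hp h0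
    obtain ⟨l, hl⟩ := IsAlgClosed.exists_root p (mt Polynomial.natDegree_eq_of_degree_eq_some h0)
    obtain ⟨q, rfl⟩ := Polynomial.dvd_iff_isRoot.mpr hl
    have hq : q ≠ 0 := right_ne_zero_of_mul hp
    rw [Polynomial.natDegree_mul (Polynomial.X_sub_C_ne_zero l) hq,
      Polynomial.natDegree_X_sub_C] at hdeg
    have hqn : q.natDegree ≤ n := by omega
    rw [add_comm n 1, Polynomial.homogenize_mul _ _ (Polynomial.natDegree_X_sub_C l).le hqn,
      map_mul, v.map_mul, add_nsmul, one_nsmul]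
    refine add_le_add ?_ (ih q hq hqn)
    simpa using hUV l

lemma exists_coprime_mul_eq_mul {a b : ℝ} (ha : a < 0) (hb : b < 0) {i j i' j' : ℕ}
    (hne : i ≠ i') (h : a * i + b * j = a * i' + b * j') :
    ∃ s t : ℕ, 0 < s ∧ 0 < t ∧ Nat.Coprime s t ∧ (s : ℝ) * a = t * b := by
  wlog hlt : i' < i generalizing i j i' j'
  · exact this hne.symm h.symm (by omega)
  have hlt' : j < j' := by
    have : (i' : ℝ) < i := by exact_mod_cast hlt
    have : (j : ℝ) < j' := by nlinarith
    exact_mod_cast this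
  obtain ⟨p, rfl⟩ := Nat.exists_eq_add_of_lt hlt
  obtain ⟨q, rfl⟩ := Nat.exists_eq_add_of_lt hlt'
  obtain ⟨g, s, t, hg, hst, hs, ht⟩ := Nat.exists_coprime' (m := p + 1) (n := q + 1)
    (Nat.gcd_pos_of_pos_left _ p.succ_pos)
  refine ⟨s, t, Nat.pos_of_ne_zero ?_, Nat.pos_of_ne_zero ?_, hst, ?_⟩
  · rintro rfl
    simp at hs
  · rintro rfl
    simp at ht
  · have hs' : (p : ℝ) + 1 = s * g := by exact_mod_cast hs
    have ht' : (q : ℝ) + 1 = t * g := by exact_mod_cast ht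
    have hg' : (g : ℝ) ≠ 0 := by exact_mod_cast hg.ne'
    push_cast at h
    apply mul_right_cancel₀ hg'
    linear_combination h - a * hs' + b * ht'

lemma mod_eq_and_div_add_div_eq {a b : ℝ} (ha : a < 0) {s t : ℕ} (hs : 0 < s) (ht : 0 < t)
    (hst : Nat.Coprime s t) (hab : (s : ℝ) * a = t * b) {i j i' j' : ℕ}
    (h : a * i + b * j = a * i' + b * j') :
    i % s = i' % s ∧ j % t = j' % t ∧ i / s + j / t = i' / s + j' / t := by
  have key : t * i + s * j = t * i' + s * j' := by
    have : a * (t * i + s * j : ℝ) = a * (t * i' + s * j') := by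
      linear_combination (t : ℝ) * h + (j - j') * hab
    exact_mod_cast mul_left_cancel₀ ha.ne this
  have h1 : i % s = i' % s := by
    refine Nat.ModEq.cancel_left_of_coprime (c := t) hst ?_
    have : (t * i + s * j) % s = (t * i' + s * j') % s := by rw [key]
    simpa [Nat.ModEq] using this
  have h2 : j % t = j' % t := by
    refine Nat.ModEq.cancel_left_of_coprime (c := s) hst.symm ?_
    have : (t * i + s * j) % t = (t * i' + s * j') % t := by rw [key]
    simpa [Nat.ModEq] using this
  refine ⟨h1, h2, ?_⟩
  have e1 := Nat.div_add_mod i s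
  have e2 := Nat.div_add_mod i' s
  have e3 := Nat.div_add_mod j t
  have e4 := Nat.div_add_mod j' t
  rw [h1] at e1
  rw [h2] at e3
  refine Nat.eq_of_mul_eq_mul_left (Nat.mul_pos hs ht) ?_
  zify at *
  linear_combination key + t * e1 + s * e3 - t * e2 - s * e4

lemma mval2_X_pow_sub_C_mul_X_pow {k : Type} [Field k] {a b : ℝ} {s t : ℕ} (hs : 0 < s)
    (hab : (s : ℝ) * a = t * b) (l : k) :
    mval2 k ![a, b] (X 0 ^ s - C l * X 1 ^ t) = (((s : ℝ) * a : ℝ) : WithTop ℝ) := by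
  classical
  have hne : (Finsupp.single 1 t : Fin 2 →₀ ℕ) ≠ Finsupp.single 0 s := fun h => by
    have := DFunLike.congr_fun h 0
    simp at this
    omega
  have hc : ∀ I, coeff I (X 0 ^ s - C l * X 1 ^ t : MvPolynomial (Fin 2) k) =
      (if Finsupp.single 0 s = I then 1 else 0) - l * if Finsupp.single 1 t = I then 1 else 0 :=
    fun I => by rw [coeff_sub, coeff_C_mul, coeff_X_pow, coeff_X_pow]
  have hw : ((∑ i, ![a, b] i * ((Finsupp.single 0 s : Fin 2 →₀ ℕ) i : ℝ) : ℝ) : WithTop ℝ) =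
      (((s : ℝ) * a : ℝ) : WithTop ℝ) := by simp [mul_comm]
  refine le_antisymm ?_ (Finset.le_inf fun I hI => ?_)
  · rw [← hw]
    refine Finset.inf_le (f := fun I : Fin 2 →₀ ℕ =>
      ((∑ i, ![a, b] i * (I i : ℝ) : ℝ) : WithTop ℝ)) ?_
    rw [mem_support_iff, hc]
    simp [hne]
  · rw [mem_support_iff, hc] at hI
    by_cases h0 : Finsupp.single 0 s = I
    · rw [← hw, h0]
    · by_cases h1 : Finsupp.single 1 t = I
      · rw [← h1, hab]
        simp [mul_comm]
      · simp [h0, h1] at hI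

/-- A weighted-homogeneous polynomial for weights with `s a = t b` is a monomial times a
homogeneous form in `X ^ s` and `Y ^ t`. -/
lemma exists_eq_monomial_mul_aeval_homogenize {k : Type} [Field k] {a b : ℝ} (ha : a < 0) {s t : ℕ} (hs : 0 < s)
    (ht : 0 < t) (hst : Nat.Coprime s t) (hab : (s : ℝ) * a = t * b)
    {L : MvPolynomial (Fin 2) k} {d : ℝ} (hL0 : L ≠ 0)
    (hL : ∀ I ∈ L.support, ∑ i, ![a, b] i * (I i : ℝ) = d) :
    ∃ (r r' n : ℕ) (p : Polynomial k), p ≠ 0 ∧ p.natDegree ≤ n ∧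
      a * r + b * r' + n * (s * a) = d ∧
      L = X 0 ^ r * X 1 ^ r' * aeval ![X 0 ^ s, X 1 ^ t] (p.homogenize n) := by
  obtain ⟨J, hJ⟩ := support_nonempty.mpr hL0
  have hmod : ∀ I ∈ L.support, I 0 % s = J 0 % s ∧ I 1 % t = J 1 % t ∧
      I 0 / s + I 1 / t = J 0 / s + J 1 / t := fun I hI => by
    refine mod_eq_and_div_add_div_eq ha hs ht hst hab ?_
    simpa using (hL I hI).trans (hL J hJ).symm
  set n := J 0 / s + J 1 / t with hn
  have hLp : L = X 0 ^ (J 0 % s) * X 1 ^ (J 1 % t) * aeval ![X 0 ^ s, X 1 ^ t]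
      ((∑ I ∈ L.support, Polynomial.monomial (I 0 / s) (L.coeff I)).homogenize n) := by
    conv_lhs => rw [L.as_sum]
    rw [Polynomial.homogenize_finsetSum, map_sum, Finset.mul_sum]
    refine Finset.sum_congr rfl fun I hI => ?_
    obtain ⟨h1, h2, h3⟩ := hmod I hI
    rw [← Polynomial.C_mul_X_pow_eq_monomial, Polynomial.homogenize_C_mul,
      Polynomial.homogenize_X_pow ((Nat.le_add_right _ _).trans_eq h3), monomial_eq,
      Finsupp.prod_fintype _ _ (by simp)]
    have h4 : n - I 0 / s = I 1 / t := Nat.sub_eq_of_eq_add' h3.symm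
    simp only [h4, Fin.prod_univ_two, map_mul, map_pow, algHom_C, aeval_X, Matrix.cons_val_zero,
      Matrix.cons_val_one, algebraMap_eq, ← pow_mul]
    conv_lhs => rw [← Nat.div_add_mod (I 0) s, ← Nat.div_add_mod (I 1) t, h1, h2, pow_add, pow_add]
    ring
  refine ⟨J 0 % s, J 1 % t, n, _, fun h => hL0 ?_, ?_, ?_, hLp⟩
  · rw [hLp, h]
    simp
  · refine Polynomial.natDegree_sum_le_of_forall_le _ _ fun I hI => ?_
    exact (Polynomial.natDegree_monomial_le _).trans
      ((Nat.le_add_right _ _).trans_eq (hmod I hI).2.2)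
  · rw [← hL J hJ, hn]
    have e1 : (s : ℝ) * (J 0 / s : ℕ) + (J 0 % s : ℕ) = J 0 := by
      exact_mod_cast Nat.div_add_mod (J 0) s
    have e2 : (t : ℝ) * (J 1 / t : ℕ) + (J 1 % t : ℕ) = J 1 := by
      exact_mod_cast Nat.div_add_mod (J 1) t
    simp only [Fin.sum_univ_two, Matrix.cons_val_zero, Matrix.cons_val_one]
    rw [Nat.cast_add]
    linear_combination a * e1 + b * e2 + (J 1 / t : ℕ) * hab

/-- Proposition 4.13 (ii): if `μ` is a valuation on `k[X,Y]` with values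
in `ℝ^{≤0} ∪ {+∞}`, `μ(X) = a < 0`, `μ(Y) = b < 0`, and `μ ≠ μ₀` where `μ₀` is the
monomial valuation with weights `(a, b)`, then there are coprime positive integers
`s₁, s₂` with `s₁·a = s₂·b` and a unique `λ ∈ k` — necessarily nonzero — such that
`H = X^{s₁} - λ·Y^{s₂}` satisfies `μ(H) > μ₀(H) = s₁·a`. -/
theorem exists_key_polynomial (k : Type) [Field k] [IsAlgClosed k] [CharZero k]
    (μ : MvPolynomial (Fin 2) k → WithTop ℝ)
    (hval : IsValuation k (MvPolynomial (Fin 2) k) μ)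
    (hneg : ∀ R : MvPolynomial (Fin 2) k, μ R ≤ 0 ∨ μ R = ⊤)
    (a b : ℝ) (ha : μ (X 0) = (a : WithTop ℝ)) (hb : μ (X 1) = (b : WithTop ℝ))
    (ha0 : a < 0) (hb0 : b < 0)
    (hne : μ ≠ mval2 k ![a, b]) :
    ∃ s1 s2 : ℕ, 0 < s1 ∧ 0 < s2 ∧ Nat.Coprime s1 s2 ∧
      (s1 : ℝ) * a = (s2 : ℝ) * b ∧
      ∃ lam : k, lam ≠ 0 ∧
        mval2 k ![a, b] (X 0 ^ s1 - C lam * X 1 ^ s2) = (((s1 : ℝ) * a : ℝ) : WithTop ℝ) ∧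
        mval2 k ![a, b] (X 0 ^ s1 - C lam * X 1 ^ s2)
          < μ (X 0 ^ s1 - C lam * X 1 ^ s2) ∧
        ∀ lam' : k,
          mval2 k ![a, b] (X 0 ^ s1 - C lam' * X 1 ^ s2)
              < μ (X 0 ^ s1 - C lam' * X 1 ^ s2) → lam' = lam := by
  obtain ⟨htop, hC, hmul, hadd⟩ := hval
  have hone : μ 1 = 0 := by simpa using hC 1 one_ne_zero
  let v : AddValuation (MvPolynomial (Fin 2) k) (WithTop ℝ) :=
    AddValuation.of μ ((htop 0).mpr rfl) hone hadd hmul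
  have hCv : ∀ c : k, c ≠ 0 → v (C c) = 0 := hC
  change v (X 0) = a at ha
  change v (X 1) = b at hb
  obtain ⟨R, hR⟩ := Function.ne_iff.mp hne
  obtain ⟨L, d, hL0, hLw, hLd⟩ := exists_weightedHomogeneous_lt_addValuation v hCv ha hb hR
  have hpair : ∃ I ∈ L.support, ∃ J ∈ L.support, I 0 ≠ J 0 := by
    by_contra! hall
    obtain ⟨J, hJ⟩ := support_nonempty.mpr hL0
    have hsupp : L.support = {J} := by
      refine Finset.eq_singleton_iff_unique_mem.mpr ⟨hJ, fun I hI => ?_⟩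
      have h0 := hall I hI J hJ
      have hw := (hLw I hI).trans (hLw J hJ).symm
      simp only [Fin.sum_univ_two, Matrix.cons_val_zero, Matrix.cons_val_one, h0,
        add_right_inj, mul_right_inj' hb0.ne, Nat.cast_inj] at hw
      ext i
      fin_cases i
      · exact h0
      · exact hw
    rw [L.as_sum, hsupp, Finset.sum_singleton,
      addValuation_monomial v hCv ha hb J (mem_support_iff.mp hJ), hLw J hJ] at hLd
    exact lt_irrefl _ hLd
  obtain ⟨I, hI, J, hJ, hIJ⟩ := hpair
  obtain ⟨s, t, hs, ht, hst, hab⟩ := exists_coprime_mul_eq_mul ha0 hb0 hIJ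
    (j := I 1) (j' := J 1) (by simpa using (hLw I hI).trans (hLw J hJ).symm)
  have hU : v (X 0 ^ s) = (((s : ℝ) * a : ℝ) : WithTop ℝ) := by
    rw [v.map_pow, ha, ← WithTop.coe_nsmul, nsmul_eq_mul]
  have hV : v (X 1 ^ t) = (((s : ℝ) * a : ℝ) : WithTop ℝ) := by
    rw [v.map_pow, hb, ← WithTop.coe_nsmul, nsmul_eq_mul, hab]
  obtain ⟨l, hl⟩ : ∃ l : k, (((s : ℝ) * a : ℝ) : WithTop ℝ) < v (X 0 ^ s - C l * X 1 ^ t) := by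
    by_contra! hall
    obtain ⟨r, r', n, p, hp, hdeg, hd, hLp⟩ :=
      exists_eq_monomial_mul_aeval_homogenize ha0 hs ht hst hab hL0 hLw
    have hle := addValuation_aeval_homogenize_le v hC hV.le hall n p hp hdeg
    refine hLd.not_ge ?_
    rw [hLp, v.map_mul, v.map_mul, v.map_pow, v.map_pow, ha, hb, ← hd]
    refine (add_le_add_right hle _).trans (le_of_eq ?_)
    simp only [← WithTop.coe_nsmul, ← WithTop.coe_add, nsmul_eq_mul, mul_comm]
  refine ⟨s, t, hs, ht, hst, hab, l, ?_, mval2_X_pow_sub_C_mul_X_pow hs hab l, ?_, ?_⟩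
  · rintro rfl
    rw [C_0, zero_mul, sub_zero, hU] at hl
    exact lt_irrefl _ hl
  · rw [mval2_X_pow_sub_C_mul_X_pow hs hab]
    exact hl
  · intro l' hl'
    rw [mval2_X_pow_sub_C_mul_X_pow hs hab] at hl'
    change _ < v _ at hl'
    by_contra hne
    have hdiff : v (C (l' - l) * X 1 ^ t) = (((s : ℝ) * a : ℝ) : WithTop ℝ) := by
      rw [v.map_mul, hCv _ (sub_ne_zero.mpr hne), zero_add, hV]
    have hlt := v.map_lt_add hl ((v.map_neg (X 0 ^ s - C l' * X 1 ^ t)).symm ▸ hl')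
    rw [show X 0 ^ s - C l * X 1 ^ t + -(X 0 ^ s - C l' * X 1 ^ t) =
      C (l' - l) * (X 1 : MvPolynomial (Fin 2) k) ^ t by rw [C_sub]; ring, hdiff] at hlt
    exact lt_irrefl _ hlt
end
end
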